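/- Let n ≥ 2 be even and let f ∈ C^∞(ℝⁿ) with ∫_{ℝⁿ}|f| dx < ∞. Then v(x) := (1/(2c_n)) ∫_{ℝⁿ} log(|y|/|x−y|) f(y) dy is absolutely convergent for every x, v is smooth on ℝⁿ, and (−Δ)^{n/2} v = f on ℝⁿ. In particular, for u ∈ C^∞(ℝⁿ) with f := (−Δ)^{n/2}u integrable, the function h := u − v satisfies Δ^{n/2} h ≡ 0 on ℝⁿ. -/

import Mathlib

open MeasureTheory Metric Filter Set

noncomputable section

/-- Euclidean space `ℝⁿ`. -/
abbrev Eu (n : ℕ) := EuclideanSpace ℝ (Fin n)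

/-- The Euclidean Laplacian `Δu(x) = ∑ᵢ ∂²u/∂xᵢ²`. -/
def lap {n : ℕ} (u : Eu n → ℝ) (x : Eu n) : ℝ :=
  ∑ i : Fin n, iteratedFDeriv ℝ 2 u x ![EuclideanSpace.single i 1, EuclideanSpace.single i 1]

/-- Iterated Laplacian `Δᵏ`. -/
def lapIter {n : ℕ} : ℕ → (Eu n → ℝ) → Eu n → ℝ
  | 0, u => u
  | k + 1, u => lap (lapIter k u)

/-- The constant `c_n = 2^(n-2) ((n-2)/2)! π^(n/2)`. -/
def cQ (n : ℕ) : ℝ := 2 ^ (n - 2) * (Nat.factorial ((n - 2) / 2)) * Real.pi ^ (n / 2)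

open scoped ContDiff Topology

lemma lap_congr {n : ℕ} {u w : Eu n → ℝ} {x : Eu n} (h : u =ᶠ[𝓝 x] w) : lap u x = lap w x := by
  simp only [lap, (h.iteratedFDeriv ℝ 2).eq_of_nhds]

lemma lapIter_congr {n : ℕ} {u w : Eu n → ℝ} {U : Set (Eu n)} (hU : IsOpen U) (h : EqOn u w U)
    (k : ℕ) : EqOn (lapIter k u) (lapIter k w) U := by
  induction k with
  | zero => exact h
  | succ k ih => exact fun x hx => lap_congr (ih.eventuallyEq_of_mem (hU.mem_nhds hx))

lemma lap_eq_sum_fderiv {n : ℕ} {u : Eu n → ℝ} {x : Eu n} (h : ContDiffAt ℝ 2 u x) :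
    lap u x = ∑ i, fderiv ℝ (fun y => fderiv ℝ u y (EuclideanSpace.single i 1)) x
      (EuclideanSpace.single i 1) := by
  refine Finset.sum_congr rfl fun i _ => ?_
  have hd : DifferentiableAt ℝ (fderiv ℝ u) x :=
    (h.fderiv_right (m := 1) (by norm_num)).differentiableAt (by norm_num)
  rw [iteratedFDeriv_two_apply, fderiv_clm_apply hd (differentiableAt_const _)]
  simp

lemma ContDiffAt.lap {n : ℕ} {u : Eu n → ℝ} {x : Eu n} (h : ContDiffAt ℝ ∞ u x) :
    ContDiffAt ℝ ∞ (lap u) x := by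
  unfold _root_.lap
  refine ContDiffAt.sum fun i _ => ?_
  have := h.iteratedFDeriv_right (m := ∞) (i := 2) le_rfl
  exact (ContinuousMultilinearMap.apply ℝ (fun _ : Fin 2 => Eu n) ℝ
    ![EuclideanSpace.single i 1, EuclideanSpace.single i 1]).contDiff.contDiffAt.comp x this

lemma ContDiffAt.lapIter {n : ℕ} {u : Eu n → ℝ} {x : Eu n} (h : ContDiffAt ℝ ∞ u x) (k : ℕ) :
    ContDiffAt ℝ ∞ (lapIter k u) x := by
  induction k with
  | zero => exact h
  | succ k ih => exact ih.lap

lemma ContDiff.lapIter {n : ℕ} {u : Eu n → ℝ} (h : ContDiff ℝ ∞ u) (k : ℕ) :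
    ContDiff ℝ ∞ (lapIter k u) :=
  contDiff_iff_contDiffAt.2 fun _ => h.contDiffAt.lapIter k

lemma ContDiff.lap {n : ℕ} {u : Eu n → ℝ} (h : ContDiff ℝ ∞ u) : ContDiff ℝ ∞ (lap u) :=
  h.lapIter 1

lemma lap_comp_add_right {n : ℕ} (u : Eu n → ℝ) (a x : Eu n) :
    lap (fun z => u (z + a)) x = lap u (x + a) := by
  simp only [lap, iteratedFDeriv_comp_add_right]

lemma lapIter_comp_add_right {n : ℕ} (u : Eu n → ℝ) (a : Eu n) (k : ℕ) :
    lapIter k (fun z => u (z + a)) = fun x => lapIter k u (x + a) := by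
  induction k with
  | zero => rfl
  | succ k ih => ext x; simp only [lapIter, ih, lap_comp_add_right]

lemma lap_const_mul {n : ℕ} {u : Eu n → ℝ} {x : Eu n} (c : ℝ) (h : ContDiffAt ℝ 2 u x) :
    lap (fun z => c * u z) x = c * lap u x := by
  have : (fun z => c * u z) = c • u := rfl
  simp only [lap, this, iteratedFDeriv_const_smul_apply (i := 2) h, Finset.mul_sum]
  rfl

lemma lap_sub {n : ℕ} {u w : Eu n → ℝ} {x : Eu n} (hu : ContDiffAt ℝ 2 u x)
    (hw : ContDiffAt ℝ 2 w x) : lap (fun z => u z - w z) x = lap u x - lap w x := by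
  have : (fun z => u z - w z) = u - w := rfl
  simp only [lap, this, iteratedFDeriv_sub_apply (i := 2) hu hw, ← Finset.sum_sub_distrib]
  rfl

lemma lapIter_const_mul {n : ℕ} {u : Eu n → ℝ} (c : ℝ) {U : Set (Eu n)} (hU : IsOpen U)
    (h : ∀ x ∈ U, ContDiffAt ℝ ∞ u x) (k : ℕ) :
    ∀ x ∈ U, lapIter k (fun z => c * u z) x = c * lapIter k u x := by
  induction k with
  | zero => exact fun _ _ => rfl
  | succ k ih =>
    intro x hx
    rw [lapIter, lap_congr (EqOn.eventuallyEq_of_mem ih (hU.mem_nhds hx)), lapIter,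
      lap_const_mul c (((h x hx).lapIter k).of_le (by norm_cast))]

lemma lapIter_sub {n : ℕ} {u w : Eu n → ℝ} {U : Set (Eu n)} (hU : IsOpen U)
    (hu : ∀ x ∈ U, ContDiffAt ℝ ∞ u x) (hw : ∀ x ∈ U, ContDiffAt ℝ ∞ w x) (k : ℕ) :
    ∀ x ∈ U, lapIter k (fun z => u z - w z) x = lapIter k u x - lapIter k w x := by
  induction k with
  | zero => exact fun _ _ => rfl
  | succ k ih =>
    intro x hx
    rw [lapIter, lap_congr (EqOn.eventuallyEq_of_mem ih (hU.mem_nhds hx)), lapIter, lapIter,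
      lap_sub (((hu x hx).lapIter k).of_le (by norm_cast))
        (((hw x hx).lapIter k).of_le (by norm_cast))]

lemma lapIter_const {n : ℕ} (c : ℝ) {k : ℕ} (hk : 1 ≤ k) (x : Eu n) :
    lapIter k (fun _ : Eu n => c) x = 0 := by
  have h0 : ∀ c : ℝ, lap (fun _ : Eu n => c) = fun _ => 0 := by
    intro c
    ext x
    simp [lap, iteratedFDeriv_const_of_ne (two_ne_zero)]
  suffices ∀ j, lapIter (j + 1) (fun _ : Eu n => c) = fun _ => 0 by
    obtain ⟨j, rfl⟩ := Nat.exists_eq_add_of_le' hk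
    rw [this]
  intro j
  induction j with
  | zero => exact h0 c
  | succ j ih => rw [lapIter, ih, h0]

lemma lap_comp_norm_sq {n : ℕ} {F F' : ℝ → ℝ} {F'' δ : ℝ} {x : Eu n}
    (hF : ContDiffAt ℝ 2 F (‖x‖ ^ 2 + δ))
    (hF' : ∀ᶠ s in 𝓝 (‖x‖ ^ 2 + δ), HasDerivAt F (F' s) s)
    (hF'' : HasDerivAt F' F'' (‖x‖ ^ 2 + δ)) :
    lap (fun z => F (‖z‖ ^ 2 + δ)) x = 4 * ‖x‖ ^ 2 * F'' + 2 * n * F' (‖x‖ ^ 2 + δ) := by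
  have hq : ∀ y : Eu n, HasFDerivAt (fun z : Eu n => ‖z‖ ^ 2 + δ) (2 • innerSL ℝ y) y := fun y =>
    (hasStrictFDerivAt_norm_sq y).hasFDerivAt.add_const δ
  have hqc : ContDiff ℝ 2 (fun z : Eu n => ‖z‖ ^ 2 + δ) := (contDiff_norm_sq ℝ).add contDiff_const
  have hin : ∀ (y : Eu n) (i : Fin n), inner ℝ y (EuclideanSpace.single i (1 : ℝ)) = y i := by
    intro y i
    simp [EuclideanSpace.inner_single_right]
  have hc : ContDiffAt ℝ 2 (fun z : Eu n => F (‖z‖ ^ 2 + δ)) x := hF.comp x hqc.contDiffAt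
  rw [lap_eq_sum_fderiv hc]
  have hfirst : ∀ i : Fin n,
      (fun y => fderiv ℝ (fun z : Eu n => F (‖z‖ ^ 2 + δ)) y (EuclideanSpace.single i 1)) =ᶠ[𝓝 x]
        fun y => F' (‖y‖ ^ 2 + δ) * (2 * inner ℝ y (EuclideanSpace.single i (1 : ℝ))) := by
    intro i
    filter_upwards [(hqc.continuous.tendsto x).eventually hF'] with y hy
    have := hy.comp_hasFDerivAt y (hq y)
    have h2 : fderiv ℝ (fun z : Eu n => F (‖z‖ ^ 2 + δ)) y = _ := this.fderiv
    rw [h2]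
    simp
  have hsecond : ∀ i : Fin n,
      fderiv ℝ (fun y => fderiv ℝ (fun z : Eu n => F (‖z‖ ^ 2 + δ)) y
        (EuclideanSpace.single i 1)) x (EuclideanSpace.single i 1) =
        4 * F'' * (x i) ^ 2 + 2 * F' (‖x‖ ^ 2 + δ) := by
    intro i
    rw [(hfirst i).fderiv_eq]
    have h1 := hF''.comp_hasFDerivAt x (hq x)
    have h2 : HasFDerivAt (fun y : Eu n => 2 * inner ℝ y (EuclideanSpace.single i (1 : ℝ)))
        ((2 : ℝ) • innerSL ℝ (EuclideanSpace.single i (1 : ℝ))) x := by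
      have :=
        ((innerSL ℝ (EuclideanSpace.single i (1 : ℝ))).hasFDerivAt (x := x)).const_smul (2 : ℝ)
      refine this.congr_of_eventuallyEq (Eventually.of_forall fun y => ?_)
      simp [real_inner_comm]
    have h3 : fderiv ℝ (fun y : Eu n => F' (‖y‖ ^ 2 + δ) *
        (2 * inner ℝ y (EuclideanSpace.single i (1 : ℝ)))) x = _ := (h1.mul h2).fderiv
    rw [h3]
    simp [hin]
    ring
  rw [Finset.sum_congr rfl fun i _ => hsecond i, Finset.sum_add_distrib, ← Finset.mul_sum,
    EuclideanSpace.real_norm_sq_eq x]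
  simp
  ring

lemma lap_zpow_norm_sq {n : ℕ} {δ : ℝ} {x : Eu n} (k : ℤ) (hx : 0 < ‖x‖ ^ 2 + δ) :
    lap (fun z : Eu n => (‖z‖ ^ 2 + δ) ^ k) x =
      2 * k * (2 * (k - 1) + n) * (‖x‖ ^ 2 + δ) ^ (k - 1) -
        4 * k * (k - 1) * δ * (‖x‖ ^ 2 + δ) ^ (k - 2) := by
  rw [lap_comp_norm_sq (F := fun s => s ^ k) (F' := fun s => k * s ^ (k - 1))
    (F'' := k * ((k - 1 : ℤ) * (‖x‖ ^ 2 + δ) ^ (k - 1 - 1)))]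
  · have : (‖x‖ ^ 2 + δ) ^ (k - 1) = (‖x‖ ^ 2 + δ) * (‖x‖ ^ 2 + δ) ^ (k - 2) := by
      rw [← zpow_one_add₀ hx.ne']
      ring_nf
    rw [show k - 1 - 1 = k - 2 by ring, this]
    push_cast
    ring
  · cases k with
    | ofNat j => simpa using contDiffAt_id.pow j
    | negSucc j => simpa [Pi.inv_def] using (contDiffAt_id.pow (j + 1)).inv (pow_ne_zero _ hx.ne')
  · filter_upwards [eventually_ne_nhds hx.ne'] with s hs
    exact hasDerivAt_zpow k s (Or.inl hs)
  · exact (hasDerivAt_zpow (k - 1) _ (Or.inl hx.ne')).const_mul _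

lemma lap_log_norm_sq {n : ℕ} {δ : ℝ} {x : Eu n} (hx : 0 < ‖x‖ ^ 2 + δ) :
    lap (fun z : Eu n => Real.log (‖z‖ ^ 2 + δ)) x =
      2 * (n - 2) * (‖x‖ ^ 2 + δ) ^ (-1 : ℤ) + 4 * δ * (‖x‖ ^ 2 + δ) ^ (-2 : ℤ) := by
  rw [lap_comp_norm_sq (F := Real.log) (F' := fun s => s⁻¹) (F'' := -((‖x‖ ^ 2 + δ) ^ 2)⁻¹)]
  · have : (‖x‖ ^ 2 + δ) ^ (-1 : ℤ) = (‖x‖ ^ 2 + δ) * (‖x‖ ^ 2 + δ) ^ (-2 : ℤ) := by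
      rw [← zpow_one_add₀ hx.ne']
      norm_num
    have h2 : ((‖x‖ ^ 2 + δ) ^ 2)⁻¹ = (‖x‖ ^ 2 + δ) ^ (-2 : ℤ) := by
      rw [zpow_neg]
      norm_cast
    rw [h2, ← zpow_neg_one, this]
    ring
  · exact Real.contDiffAt_log.2 hx.ne'
  · filter_upwards [eventually_ne_nhds hx.ne'] with s hs
    exact Real.hasDerivAt_log hs
  · exact hasDerivAt_inv hx.ne'

lemma contDiffAt_log_norm_sq {n : ℕ} {δ : ℝ} {x : Eu n} (hx : 0 < ‖x‖ ^ 2 + δ) :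
    ContDiffAt ℝ ∞ (fun z : Eu n => Real.log (‖z‖ ^ 2 + δ)) x :=
  ((contDiff_norm_sq ℝ).add contDiff_const).contDiffAt.log hx.ne'

lemma contDiffAt_zpow_norm_sq {n : ℕ} {δ : ℝ} {x : Eu n} (k : ℤ) (hx : 0 < ‖x‖ ^ 2 + δ) :
    ContDiffAt ℝ ∞ (fun z : Eu n => (‖z‖ ^ 2 + δ) ^ k) x := by
  have h : ContDiffAt ℝ ∞ (fun z : Eu n => ‖z‖ ^ 2 + δ) x :=
    ((contDiff_norm_sq ℝ).add contDiff_const).contDiffAt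
  cases k with
  | ofNat j => simpa using h.pow j
  | negSucc j => simpa [Pi.inv_def] using (h.pow (j + 1)).inv (pow_ne_zero _ hx.ne')

/-- Away from the origin `log ‖x‖` is polyharmonic of order `n / 2`. -/
lemma lapIter_log_norm_sq {m : ℕ} (hm : 1 ≤ m) {x : Eu (m + m)} (hx : x ≠ 0) :
    lapIter m (fun z : Eu (m + m) => Real.log (‖z‖ ^ 2)) x = 0 := by
  have hU : IsOpen ({0}ᶜ : Set (Eu (m + m))) := isOpen_compl_singleton
  have hpos : ∀ y : Eu (m + m), y ∈ ({0}ᶜ : Set _) → 0 < ‖y‖ ^ 2 + 0 := by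
    intro y hy
    have := norm_pos_iff.2 hy
    positivity
  suffices ∀ p : ℕ, ∃ c : ℝ, ∀ y ∈ ({0}ᶜ : Set (Eu (m + m))),
      lapIter (p + 1) (fun z : Eu (m + m) => Real.log (‖z‖ ^ 2)) y =
        c * (m - 1 - p) * (‖y‖ ^ 2) ^ (-(p + 1) : ℤ) by
    obtain ⟨p, rfl⟩ := Nat.exists_eq_add_of_le' hm
    obtain ⟨c, hc⟩ := this p
    rw [hc x hx]
    simp
  intro p
  induction p with
  | zero =>
    refine ⟨4, fun y hy => ?_⟩
    have := lap_log_norm_sq (hpos y hy)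
    simp only [add_zero] at this
    simp only [lapIter, this]
    push_cast
    ring
  | succ p ih =>
    obtain ⟨c, hc⟩ := ih
    refine ⟨c * (m - 1 - p) * (-4 * (p + 1)), fun y hy => ?_⟩
    rw [lapIter, lap_congr (EqOn.eventuallyEq_of_mem hc (hU.mem_nhds hy)), lap_const_mul]
    · have := lap_zpow_norm_sq (-(p + 1) : ℤ) (hpos y hy)
      simp only [add_zero] at this
      rw [this]
      push_cast
      rw [show (-(p + 1) - 1 : ℤ) = -(p + 1 + 1) by ring]
      ring
    · have := contDiffAt_zpow_norm_sq (-(p + 1) : ℤ) (hpos y hy)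
      simp only [add_zero] at this
      exact this.of_le (by norm_cast)

lemma nontrivial_Eu {n : ℕ} (hn : 1 ≤ n) : Nontrivial (Eu n) := by
  have : Nonempty (Fin n) := ⟨⟨0, hn⟩⟩
  infer_instance

lemma HasCompactSupport.lap {n : ℕ} {φ : Eu n → ℝ} (h : HasCompactSupport φ) :
    HasCompactSupport (lap φ) := by
  refine h.mono' fun x hx => ?_
  by_contra hxs
  refine hx ?_
  rw [lap_congr (notMem_tsupport_iff_eventuallyEq.1 hxs)]
  exact lapIter_const (n := n) 0 (le_refl 1) x

lemma HasCompactSupport.lapIter {n : ℕ} {φ : Eu n → ℝ} (h : HasCompactSupport φ) (k : ℕ) :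
    HasCompactSupport (lapIter k φ) := by
  induction k with
  | zero => exact h
  | succ k ih => exact ih.lap

/-- Green's second identity for a compactly supported test function. -/
lemma integral_mul_lap {n : ℕ} {u φ : Eu n → ℝ} (hu : ContDiff ℝ ∞ u) (hφ : ContDiff ℝ ∞ φ)
    (hc : HasCompactSupport φ) : ∫ x, u x * lap φ x = ∫ x, lap u x * φ x := by
  have hd : ∀ {w : Eu n → ℝ}, ContDiff ℝ ∞ w → ∀ v : Eu n,
      ContDiff ℝ ∞ fun y => fderiv ℝ w y v := fun hw v =>
    (hw.fderiv_right (m := ∞) (by norm_cast)).clm_apply contDiff_const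
  have hcd : ∀ {w : Eu n → ℝ}, HasCompactSupport w → ∀ v : Eu n,
      HasCompactSupport fun y => fderiv ℝ w y v := fun hw v => hw.fderiv_apply ℝ v
  have hint : ∀ {a b : Eu n → ℝ}, ContDiff ℝ ∞ a → ContDiff ℝ ∞ b → HasCompactSupport b →
      Integrable fun x => a x * b x := fun ha hb hcb =>
    (ha.continuous.mul hb.continuous).integrable_of_hasCompactSupport hcb.mul_left
  have hdiff : ∀ {w : Eu n → ℝ}, ContDiff ℝ ∞ w → Differentiable ℝ w := fun hw =>
    hw.differentiable (by simp)
  have h2 : ∀ {w : Eu n → ℝ}, ContDiff ℝ ∞ w → ∀ x, ContDiffAt ℝ 2 w x := fun hw x =>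
    hw.contDiffAt.of_le (by norm_cast)
  simp only [lap_eq_sum_fderiv (h2 hu _), lap_eq_sum_fderiv (h2 hφ _), Finset.mul_sum,
    Finset.sum_mul]
  rw [integral_finsetSum _ fun i _ => hint hu (hd (hd hφ _) _) (hcd (hcd hc _) _),
    integral_finsetSum _ fun i _ => hint (hd (hd hu _) _) hφ hc]
  refine Finset.sum_congr rfl fun i _ => ?_
  set e : Eu n := EuclideanSpace.single i 1
  rw [integral_mul_fderiv_eq_neg_fderiv_mul_of_integrable
      (hint (hd hu e) (hd hφ e) (hcd hc e)) (hint hu (hd (hd hφ e) e) (hcd (hcd hc e) e))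
      (hint hu (hd hφ e) (hcd hc e)) (fun x _ => hdiff hu x) (fun x _ => hdiff (hd hφ e) x),
    integral_mul_fderiv_eq_neg_fderiv_mul_of_integrable
      (hint (hd (hd hu e) e) hφ hc) (hint (hd hu e) (hd hφ e) (hcd hc e))
      (hint (hd hu e) hφ hc) (fun x _ => hdiff (hd hu e) x) (fun x _ => hdiff hφ x), neg_neg]

lemma locallyIntegrable_comp_norm {n : ℕ} (hn : 1 ≤ n) {F g : ℝ → ℝ} (hg : Continuous g)
    (hF : ∀ y, 0 < y → y ^ (n - 1) * F y = g y) :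
    LocallyIntegrable (fun x : Eu n => F ‖x‖) := by
  have := nontrivial_Eu hn
  intro x
  refine ⟨ball 0 (‖x‖ + 1), isOpen_ball.mem_nhds (by simp), ?_⟩
  rw [integrableOn_fun_norm_addHaar, finrank_euclideanSpace_fin]
  refine IntegrableOn.congr_fun ((hg.integrableOn_Icc (a := 0) (b := ‖x‖ + 1)).mono_set
    Ioo_subset_Icc_self) (fun y hy => ?_) measurableSet_Ioo
  simp [hF y hy.1]

lemma locallyIntegrable_zpow_norm_sq {n k : ℕ} (hk : 2 * k < n) :
    LocallyIntegrable (fun x : Eu n => (‖x‖ ^ 2) ^ (-k : ℤ)) := by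
  refine locallyIntegrable_comp_norm (by omega) (F := fun y => (y ^ 2) ^ (-k : ℤ))
    (continuous_pow (n - 1 - 2 * k)) fun y hy => ?_
  rw [show n - 1 = (n - 1 - 2 * k) + 2 * k by omega, pow_add, zpow_neg, zpow_natCast, ← pow_mul,
    mul_assoc, mul_inv_cancel₀ (by positivity), mul_one]
  congr 1
  omega

lemma locallyIntegrable_log_norm_sq {n : ℕ} (hn : 2 ≤ n) :
    LocallyIntegrable (fun x : Eu n => Real.log (‖x‖ ^ 2)) := by
  refine locallyIntegrable_comp_norm (by omega) (F := fun y => Real.log (y ^ 2))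
    (g := fun y => y ^ (n - 2) * (2 * (y * Real.log y)))
    ((continuous_pow _).mul (Real.continuous_mul_log.const_mul 2)) fun y hy => ?_
  rw [show n - 1 = (n - 2) + 1 by omega, pow_succ, Real.log_pow]
  push_cast
  ring_nf

lemma MeasureTheory.LocallyIntegrable.integrable_mul_of_hasCompactSupport {n : ℕ} {b φ : Eu n → ℝ}
    (hb : LocallyIntegrable b) (hφ : Continuous φ) (hc : HasCompactSupport φ) :
    Integrable fun x => b x * φ x :=
  hb.integrable_smul_right_of_hasCompactSupport hφ hc

lemma tendsto_integral_mul_of_locallyIntegrable {n : ℕ} (hn : 1 ≤ n) {K : ℝ → Eu n → ℝ}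
    {K₀ b φ : Eu n → ℝ} (hφ : Continuous φ) (hc : HasCompactSupport φ)
    (hb : LocallyIntegrable b) (hK : ∀ δ, 0 < δ → Continuous (K δ))
    (hKb : ∀ δ, 0 < δ → δ < 1 → ∀ x, x ≠ 0 → |K δ x| ≤ b x)
    (hlim : ∀ x, x ≠ 0 → Tendsto (fun δ => K δ x) (𝓝[>] 0) (𝓝 (K₀ x))) :
    Tendsto (fun δ => ∫ x, K δ x * φ x) (𝓝[>] 0) (𝓝 (∫ x, K₀ x * φ x)) := by
  have := nontrivial_Eu hn
  have hne : ∀ᵐ x : Eu n, x ≠ 0 := Measure.ae_ne volume 0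
  refine tendsto_integral_filter_of_dominated_convergence (fun x => ‖b x * φ x‖) ?_ ?_
    (hb.integrable_mul_of_hasCompactSupport hφ hc).norm ?_
  · filter_upwards [self_mem_nhdsWithin] with δ hδ
    exact ((hK δ hδ).mul hφ).aestronglyMeasurable
  · filter_upwards [Ioo_mem_nhdsGT (zero_lt_one' ℝ)] with δ hδ
    filter_upwards [hne] with x hx
    rw [norm_mul, norm_mul]
    gcongr
    exact (hKb δ hδ.1 hδ.2 x hx).trans (le_abs_self _)
  · filter_upwards [hne] with x hx
    exact (hlim x hx).mul_const _

lemma continuous_zpow_norm_sq_add {n : ℕ} {δ : ℝ} (hδ : 0 < δ) (k : ℤ) :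
    Continuous fun x : Eu n => (‖x‖ ^ 2 + δ) ^ k := by
  refine Continuous.zpow₀ (by fun_prop) k fun x => Or.inl ?_
  positivity

lemma zpow_neg_norm_sq_add_le {n : ℕ} {δ : ℝ} (hδ : 0 < δ) (k : ℕ) {x : Eu n} (hx : x ≠ 0) :
    (‖x‖ ^ 2 + δ) ^ (-k : ℤ) ≤ (‖x‖ ^ 2) ^ (-k : ℤ) := by
  have := norm_pos_iff.2 hx
  rw [zpow_neg, zpow_neg, zpow_natCast, zpow_natCast]
  gcongr
  linarith

lemma tendsto_zpow_norm_sq_add {n : ℕ} (k : ℤ) {x : Eu n} (hx : x ≠ 0) :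
    Tendsto (fun δ : ℝ => (‖x‖ ^ 2 + δ) ^ k) (𝓝[>] 0) (𝓝 ((‖x‖ ^ 2) ^ k)) := by
  have h0 : ‖x‖ ^ 2 ≠ 0 := by simpa using hx
  have : ContinuousAt (fun δ : ℝ => (‖x‖ ^ 2 + δ) ^ k) 0 :=
    ContinuousAt.zpow₀ (by fun_prop) k (Or.inl (by simpa using h0))
  simpa using this.tendsto.mono_left nhdsWithin_le_nhds

lemma tendsto_integral_zpow_mul {n k : ℕ} (hk : 2 * k < n) {φ : Eu n → ℝ} (hφ : Continuous φ)
    (hc : HasCompactSupport φ) :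
    Tendsto (fun δ : ℝ => ∫ x, (‖x‖ ^ 2 + δ) ^ (-k : ℤ) * φ x) (𝓝[>] 0)
      (𝓝 (∫ x, (‖x‖ ^ 2) ^ (-k : ℤ) * φ x)) := by
  refine tendsto_integral_mul_of_locallyIntegrable (by omega) hφ hc
    (locallyIntegrable_zpow_norm_sq hk) (fun δ hδ => continuous_zpow_norm_sq_add hδ _)
    (fun δ hδ _ x hx => ?_) fun x hx => tendsto_zpow_norm_sq_add _ hx
  rw [abs_of_nonneg (by positivity)]
  exact zpow_neg_norm_sq_add_le hδ k hx

lemma tendsto_integral_const_mul_zpow_mul {n k : ℕ} (hk : 2 * k < n) {φ : Eu n → ℝ}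
    (hφ : Continuous φ) (hc : HasCompactSupport φ) :
    Tendsto (fun δ : ℝ => ∫ x, δ * (‖x‖ ^ 2 + δ) ^ (-(k + 1) : ℤ) * φ x) (𝓝[>] 0) (𝓝 0) := by
  have h := tendsto_integral_mul_of_locallyIntegrable (by omega)
    (K := fun δ x => δ * (‖x‖ ^ 2 + δ) ^ (-(k + 1) : ℤ)) (K₀ := fun _ => 0) hφ hc
    (locallyIntegrable_zpow_norm_sq hk)
    (fun δ hδ => (continuous_zpow_norm_sq_add hδ _).const_mul δ) (fun δ hδ _ x hx => ?_)
    fun x hx => ?_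
  · simpa using h
  · have hs : 0 < ‖x‖ ^ 2 + δ := by positivity
    rw [abs_of_nonneg (by positivity)]
    refine le_trans ?_ (zpow_neg_norm_sq_add_le hδ k hx)
    rw [show (-k : ℤ) = 1 + -(k + 1) by ring, zpow_one_add₀ hs.ne']
    gcongr
    nlinarith [sq_nonneg ‖x‖]
  · have h1 : Tendsto (fun δ : ℝ => δ) (𝓝[>] 0) (𝓝 0) := tendsto_id.mono_left nhdsWithin_le_nhds
    simpa using h1.mul (tendsto_zpow_norm_sq_add (-(k + 1) : ℤ) hx)

lemma tendsto_integral_log_mul {n : ℕ} (hn : 2 ≤ n) {φ : Eu n → ℝ} (hφ : Continuous φ)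
    (hc : HasCompactSupport φ) :
    Tendsto (fun δ : ℝ => ∫ x, Real.log (‖x‖ ^ 2 + δ) * φ x) (𝓝[>] 0)
      (𝓝 (∫ x, Real.log (‖x‖ ^ 2) * φ x)) := by
  have hlog : Continuous fun x : Eu n => Real.log (‖x‖ ^ 2 + 1) :=
    Continuous.log (by fun_prop) fun x => by positivity
  refine tendsto_integral_mul_of_locallyIntegrable (by omega) hφ hc
    (LocallyIntegrable.add (fun x => (locallyIntegrable_log_norm_sq hn x).norm)
      hlog.locallyIntegrable)
    (fun δ hδ => Continuous.log (by fun_prop) fun x => by positivity)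
    (fun δ hδ hδ1 x hx => ?_) fun x hx => ?_
  · have h0 := norm_pos_iff.2 hx
    have h1 : Real.log (‖x‖ ^ 2) ≤ Real.log (‖x‖ ^ 2 + δ) :=
      Real.log_le_log (by positivity) (by linarith)
    have h2 : Real.log (‖x‖ ^ 2 + δ) ≤ Real.log (‖x‖ ^ 2 + 1) :=
      Real.log_le_log (by positivity) (by linarith)
    have h3 : 0 ≤ Real.log (‖x‖ ^ 2 + 1) := Real.log_nonneg (by nlinarith)
    simp only [Pi.add_apply, Real.norm_eq_abs]
    rw [abs_le]
    constructor
    · linarith [neg_abs_le (Real.log (‖x‖ ^ 2))]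
    · linarith [abs_nonneg (Real.log (‖x‖ ^ 2))]
  · have h0 : ‖x‖ ^ 2 ≠ 0 := by simpa using hx
    have : ContinuousAt (fun δ : ℝ => Real.log (‖x‖ ^ 2 + δ)) 0 :=
      ContinuousAt.log (by fun_prop) (by simpa using h0)
    simpa using this.tendsto.mono_left nhdsWithin_le_nhds

lemma hasDerivAt_sq_div_pow {m : ℕ} (hm : 1 ≤ m) (y : ℝ) :
    HasDerivAt (fun y : ℝ => (y ^ 2 / (y ^ 2 + 1)) ^ m)
      (2 * m * (y ^ (m + m - 1) * (y ^ 2 + 1) ^ (-(m + 1) : ℤ))) y := by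
  have hy : y ^ 2 + 1 ≠ 0 := by positivity
  have h := ((hasDerivAt_pow 2 y).div ((hasDerivAt_pow 2 y).add_const 1) hy).pow m
  refine h.congr_deriv ?_
  obtain ⟨k, rfl⟩ := Nat.exists_eq_add_of_le' hm
  rw [zpow_neg, show ((k + 1 : ℕ) + 1 : ℤ) = ((k + 2 : ℕ) : ℤ) by push_cast; ring, zpow_natCast,
    show k + 1 + (k + 1) - 1 = 2 * k + 1 by omega]
  simp only [Pi.div_apply]
  push_cast
  rw [div_pow]
  field_simp
  ring

lemma tendsto_sq_div_pow (m : ℕ) :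
    Tendsto (fun y : ℝ => (y ^ 2 / (y ^ 2 + 1)) ^ m) atTop (𝓝 1) := by
  have h1 : Tendsto (fun y : ℝ => y ^ 2 + 1) atTop atTop :=
    tendsto_atTop_add_const_right _ _ (tendsto_pow_atTop two_ne_zero)
  have h2 : Tendsto (fun y : ℝ => (1 - (y ^ 2 + 1)⁻¹) ^ m) atTop (𝓝 ((1 - 0) ^ m)) :=
    ((tendsto_const_nhds).sub h1.inv_tendsto_atTop).pow m
  simp only [sub_zero, one_pow] at h2
  refine h2.congr fun y => ?_
  congr 1
  have hy : y ^ 2 + 1 ≠ 0 := by positivity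
  field_simp
  ring

lemma integrable_zpow_norm_sq_add_one {m : ℕ} (hm : 1 ≤ m) :
    Integrable fun x : Eu (m + m) => (‖x‖ ^ 2 + 1) ^ (-(m + 1) : ℤ) := by
  have := nontrivial_Eu (n := m + m) (by omega)
  have h := integrableOn_Ioi_deriv_of_nonneg' (a := 0)
    (fun y _ => hasDerivAt_sq_div_pow hm y) (fun y hy => by
      have : (0 : ℝ) < y := hy
      positivity) (tendsto_sq_div_pow m)
  refine (integrable_fun_norm_addHaar volume (f := fun y => (y ^ 2 + 1) ^ (-(m + 1) : ℤ))).2 ?_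
  rw [finrank_euclideanSpace_fin]
  refine IntegrableOn.congr_fun (h.const_mul (2 * m : ℝ)⁻¹) (fun y _ => ?_) measurableSet_Ioi
  have : (m : ℝ) ≠ 0 := by positivity
  simp only [smul_eq_mul]
  field_simp

lemma integral_zpow_norm_sq_add_one {m : ℕ} (hm : 1 ≤ m) :
    ∫ x : Eu (m + m), (‖x‖ ^ 2 + 1) ^ (-(m + 1) : ℤ) = Real.pi ^ m / m.factorial := by
  have := nontrivial_Eu (n := m + m) (by omega)
  have h := integral_Ioi_of_hasDerivAt_of_nonneg' (a := 0)
    (fun y _ => hasDerivAt_sq_div_pow hm y) (fun y hy => by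
      have : (0 : ℝ) < y := hy
      positivity) (tendsto_sq_div_pow m)
  rw [integral_const_mul] at h
  rw [integral_fun_norm_addHaar volume (fun y => (y ^ 2 + 1) ^ (-(m + 1) : ℤ)), Measure.real,
    InnerProductSpace.volume_ball_of_dim_even (k := m)
      (by rw [finrank_euclideanSpace_fin]; ring), finrank_euclideanSpace_fin]
  simp only [smul_eq_mul, nsmul_eq_mul]
  rw [ENNReal.ofReal_one, one_pow, one_mul, ENNReal.toReal_ofReal (by positivity)]
  have h0 : (0 : ℝ) ^ 2 / (0 ^ 2 + 1) = 0 := by norm_num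
  rw [h0, zero_pow (by omega), sub_zero] at h
  push_cast
  linear_combination (Real.pi ^ m / m.factorial) * h

lemma tendsto_integral_approx_identity {m : ℕ} (hm : 1 ≤ m) {φ : Eu (m + m) → ℝ}
    (hφ : Continuous φ) (hc : HasCompactSupport φ) :
    Tendsto (fun δ : ℝ => ∫ x, δ * (‖x‖ ^ 2 + δ) ^ (-(m + 1) : ℤ) * φ x) (𝓝[>] 0)
      (𝓝 (Real.pi ^ m / m.factorial * φ 0)) := by
  obtain ⟨C, hC⟩ := hc.exists_bound_of_continuous hφ
  have key : ∀ δ : ℝ, 0 < δ → ∫ x : Eu (m + m), δ * (‖x‖ ^ 2 + δ) ^ (-(m + 1) : ℤ) * φ x =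
      ∫ z : Eu (m + m), (‖z‖ ^ 2 + 1) ^ (-(m + 1) : ℤ) * φ (√δ • z) := by
    intro δ hδ
    have hs : 0 < √δ := Real.sqrt_pos.2 hδ
    have h := Measure.integral_comp_smul_of_nonneg volume
      (fun x : Eu (m + m) => δ * (‖x‖ ^ 2 + δ) ^ (-(m + 1) : ℤ) * φ x) (√δ) (hR := hs.le)
    rw [finrank_euclideanSpace_fin, smul_eq_mul, inv_mul_eq_div, eq_div_iff (by positivity)] at h
    rw [← h, ← integral_mul_const]
    refine integral_congr_ae (Eventually.of_forall fun z => ?_)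
    have h1 : ‖√δ • z‖ ^ 2 + δ = δ * (‖z‖ ^ 2 + 1) := by
      rw [norm_smul, mul_pow, Real.norm_of_nonneg hs.le, Real.sq_sqrt hδ.le]
      ring
    have h2 : √δ ^ (m + m) = δ ^ m := by
      rw [← two_mul, pow_mul, Real.sq_sqrt hδ.le]
    have h3 : δ * δ ^ (-(m + 1) : ℤ) * δ ^ m = 1 := by
      rw [← zpow_one_add₀ hδ.ne', ← zpow_natCast, ← zpow_add₀ hδ.ne']
      simp
    simp only [h1, h2, mul_zpow]
    linear_combination ((‖z‖ ^ 2 + 1) ^ (-(m + 1) : ℤ) * φ (√δ • z)) * h3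
  refine Tendsto.congr' (f₁ := fun δ : ℝ =>
    ∫ z : Eu (m + m), (‖z‖ ^ 2 + 1) ^ (-(m + 1) : ℤ) * φ (√δ • z)) ?_ ?_
  · filter_upwards [self_mem_nhdsWithin] with δ hδ using (key δ hδ).symm
  rw [← integral_zpow_norm_sq_add_one hm, ← integral_mul_const]
  have hcont := continuous_zpow_norm_sq_add (n := m + m) zero_lt_one (-(m + 1) : ℤ)
  refine tendsto_integral_filter_of_dominated_convergence
    (fun z => (‖z‖ ^ 2 + 1) ^ (-(m + 1) : ℤ) * C) ?_ ?_
    ((integrable_zpow_norm_sq_add_one hm).mul_const C) ?_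
  · exact Eventually.of_forall fun δ =>
      (hcont.mul (hφ.comp (continuous_const_smul _))).aestronglyMeasurable
  · refine Eventually.of_forall fun δ => Eventually.of_forall fun z => ?_
    rw [norm_mul, Real.norm_of_nonneg (by positivity)]
    gcongr
    exact hC _
  · refine Eventually.of_forall fun z => Tendsto.const_mul _ ?_
    have : Continuous fun δ : ℝ => φ (√δ • z) :=
      hφ.comp (Real.continuous_sqrt.smul continuous_const)
    simpa using (this.tendsto 0).mono_left (nhdsWithin_le_nhds (s := Ioi 0))

lemma integral_zpow_norm_sq_add_mul_lap {n : ℕ} {δ : ℝ} (hδ : 0 < δ) (k : ℤ) {φ : Eu n → ℝ}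
    (hφ : ContDiff ℝ ∞ φ) (hc : HasCompactSupport φ) :
    ∫ x, (‖x‖ ^ 2 + δ) ^ k * lap φ x =
      2 * k * (2 * (k - 1) + n) * (∫ x, (‖x‖ ^ 2 + δ) ^ (k - 1) * φ x) -
        4 * k * (k - 1) * ∫ x, δ * (‖x‖ ^ 2 + δ) ^ (k - 2) * φ x := by
  have hpos : ∀ x : Eu n, 0 < ‖x‖ ^ 2 + δ := fun x => by positivity
  rw [integral_mul_lap (contDiff_iff_contDiffAt.2 fun x => contDiffAt_zpow_norm_sq k (hpos x)) hφ
    hc,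
    ← integral_const_mul, ← integral_const_mul, ← integral_sub]
  · refine integral_congr_ae (Eventually.of_forall fun x => ?_)
    simp only [lap_zpow_norm_sq k (hpos x)]
    ring
  · exact (((continuous_zpow_norm_sq_add hδ _).mul hφ.continuous).integrable_of_hasCompactSupport
      hc.mul_left).const_mul _
  · exact ((((continuous_zpow_norm_sq_add hδ _).const_mul δ).mul
      hφ.continuous).integrable_of_hasCompactSupport hc.mul_left).const_mul _

lemma integral_log_norm_sq_add_mul_lap {n : ℕ} {δ : ℝ} (hδ : 0 < δ) {φ : Eu n → ℝ}
    (hφ : ContDiff ℝ ∞ φ) (hc : HasCompactSupport φ) :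
    ∫ x, Real.log (‖x‖ ^ 2 + δ) * lap φ x =
      2 * (n - 2) * (∫ x, (‖x‖ ^ 2 + δ) ^ (-1 : ℤ) * φ x) +
        4 * ∫ x, δ * (‖x‖ ^ 2 + δ) ^ (-2 : ℤ) * φ x := by
  have hpos : ∀ x : Eu n, 0 < ‖x‖ ^ 2 + δ := fun x => by positivity
  rw [integral_mul_lap (contDiff_iff_contDiffAt.2 fun x => contDiffAt_log_norm_sq (hpos x)) hφ hc,
    ← integral_const_mul, ← integral_const_mul, ← integral_add]
  · refine integral_congr_ae (Eventually.of_forall fun x => ?_)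
    simp only [lap_log_norm_sq (hpos x)]
    ring
  · exact (((continuous_zpow_norm_sq_add hδ _).mul hφ.continuous).integrable_of_hasCompactSupport
      hc.mul_left).const_mul _
  · exact ((((continuous_zpow_norm_sq_add hδ _).const_mul δ).mul
      hφ.continuous).integrable_of_hasCompactSupport hc.mul_left).const_mul _

/-- The power `‖x‖ ^ (-2 (k + 1))` is a multiple of a fundamental solution of `Δ ^ (j + 1)` on
`ℝ ^ (2 m)` with `m = j + k + 2`. -/
lemma integral_zpow_norm_sq_mul_lapIter {m : ℕ} (j : ℕ) : ∀ k : ℕ, j + k + 2 = m →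
    ∀ {φ : Eu (m + m) → ℝ}, ContDiff ℝ ∞ φ → HasCompactSupport φ →
    ∫ x, (‖x‖ ^ 2) ^ (-(k + 1) : ℤ) * lapIter (j + 1) φ x =
      (-4) ^ (j + 1) * j.factorial * Real.pi ^ m / k.factorial * φ 0 := by
  induction j with
  | zero =>
    intro k hk φ hφ hc
    have h1 := tendsto_integral_zpow_mul (n := m + m) (k := k + 1) (by omega) hφ.lap.continuous
      hc.lap
    have h2 := (tendsto_integral_approx_identity (m := m) (by omega) hφ.continuous hc).const_mul
      (-(4 * (k + 1) * m) : ℝ)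
    have hkm : (m : ℝ) = k + 2 := by rw [← hk]; push_cast; ring
    have heq := tendsto_nhds_unique h1 (h2.congr' ?_)
    · push_cast at heq
      simp only [lapIter, zero_add]
      have hfac : (m.factorial : ℝ) = (k + 2) * ((k + 1) * k.factorial) := by
        rw [← hk, zero_add, Nat.factorial_succ, Nat.factorial_succ]
        push_cast
        ring
      rw [heq, hfac, hkm, Nat.factorial_zero]
      push_cast
      field_simp
    · filter_upwards [self_mem_nhdsWithin] with δ hδ
      rw [integral_zpow_norm_sq_add_mul_lap hδ _ hφ hc]
      have e1 : (-((k + 1 : ℕ) : ℤ) - 2) = -(m + 1) := by omega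
      rw [e1]
      push_cast
      rw [hkm]
      ring
  | succ j ih =>
    intro k hk φ hφ hc
    have hψ := hφ.lapIter (j + 1)
    have hψc := hc.lapIter (j + 1)
    have h1 := tendsto_integral_zpow_mul (n := m + m) (k := k + 1) (by omega) hψ.lap.continuous
      hψc.lap
    have h2 := (tendsto_integral_zpow_mul (n := m + m) (k := k + 2) (by omega)
      hψ.continuous hψc).const_mul (-(4 * (k + 1) * (j + 1)) : ℝ)
    have h3 := (tendsto_integral_const_mul_zpow_mul (n := m + m) (k := k + 2) (by omega)
      hψ.continuous hψc).const_mul (4 * (k + 1) * (k + 2) : ℝ)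
    have heq := tendsto_nhds_unique h1 ((h2.sub h3).congr' ?_)
    · have := ih (k + 1) (by omega) hφ hc
      push_cast at heq this
      rw [show (-(k + 1 + 1) : ℤ) = -(k + 2) by ring] at this
      rw [lapIter, heq, this, Nat.factorial_succ, Nat.factorial_succ]
      push_cast
      field_simp
      ring
    · filter_upwards [self_mem_nhdsWithin] with δ hδ
      rw [integral_zpow_norm_sq_add_mul_lap hδ _ hψ hψc]
      have e1 : (-((k + 1 : ℕ) : ℤ) - 2) = -((k + 2 : ℕ) + 1) := by omega
      have e2 : (-((k + 1 : ℕ) : ℤ) - 1) = -(k + 2 : ℕ) := by omega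
      have hkm : (m : ℝ) = j + 1 + k + 2 := by rw [← hk]; push_cast; ring
      rw [e1, e2]
      push_cast
      rw [hkm]
      ring

/-- `log ‖x‖ ^ 2` is a multiple of a fundamental solution of `Δ ^ m` on `ℝ ^ (2 m)`. -/
lemma integral_log_norm_sq_mul_lapIter {m : ℕ} (hm : 1 ≤ m) {φ : Eu (m + m) → ℝ}
    (hφ : ContDiff ℝ ∞ φ) (hc : HasCompactSupport φ) :
    ∫ x, Real.log (‖x‖ ^ 2) * lapIter m φ x =
      -((-4) ^ m * (m - 1).factorial * Real.pi ^ m) * φ 0 := by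
  obtain ⟨j, rfl⟩ := Nat.exists_eq_add_of_le' hm
  have hψ := hφ.lapIter j
  have hψc := hc.lapIter j
  have h1 := tendsto_integral_log_mul (by omega) hψ.lap.continuous hψc.lap
  rcases Nat.eq_zero_or_pos j with rfl | hj
  · have h2 := (tendsto_integral_approx_identity (m := 0 + 1) (by omega) hφ.continuous
      hc).const_mul (4 : ℝ)
    have heq := tendsto_nhds_unique h1 (h2.congr' ?_)
    · simp only [lapIter] at heq ⊢
      rw [heq]
      simp
      ring
    · filter_upwards [self_mem_nhdsWithin] with δ hδ
      simp only [lapIter]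
      rw [integral_log_norm_sq_add_mul_lap hδ hφ hc]
      norm_num
  · obtain ⟨i, rfl⟩ : ∃ i, j = i + 1 := Nat.exists_eq_add_of_le' hj
    have h2 := (tendsto_integral_zpow_mul (n := i + 1 + 1 + (i + 1 + 1)) (k := 1) (by omega)
      hψ.continuous hψc).const_mul (4 * (i + 1) : ℝ)
    have h3 := (tendsto_integral_const_mul_zpow_mul (n := i + 1 + 1 + (i + 1 + 1)) (k := 1)
      (by omega) hψ.continuous hψc).const_mul (4 : ℝ)
    have heq := tendsto_nhds_unique h1 ((h2.add h3).congr' ?_)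
    · have := integral_zpow_norm_sq_mul_lapIter i 0 (by omega) hφ hc
      push_cast at heq this
      rw [lapIter, heq, this, show i + 1 + 1 - 1 = i + 1 by omega, Nat.factorial_succ]
      simp
      ring
    · filter_upwards [self_mem_nhdsWithin] with δ hδ
      rw [integral_log_norm_sq_add_mul_lap hδ hψ hψc]
      push_cast
      ring

section ParametricIntegral

variable {n : ℕ} {F : Type} [NormedAddCommGroup F] [NormedSpace ℝ F]
  {Ω : Set (Eu n × Eu n)} {U K : Set (Eu n)} {f : Eu n → ℝ} {T : Eu n → Eu n}

lemma integrable_smul_comp_prodMk {H : Eu n × Eu n → F} (hH : ContinuousOn H Ω)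
    (hK : IsCompact K) (hUK : U ×ˢ K ⊆ Ω) (hf : Integrable f) (hT : Measurable T)
    (hTK : ∀ y, T y ∈ K) {x : Eu n} (hx : x ∈ U) :
    Integrable fun y => f y • H (x, T y) := by
  have hcont : ContinuousOn (fun w => H (x, w)) K :=
    hH.comp (by fun_prop) fun w hw => hUK ⟨hx, hw⟩
  obtain ⟨C, hC⟩ := hK.exists_bound_of_continuousOn hcont
  have hm : StronglyMeasurable fun y => H (x, T y) :=
    (continuousOn_iff_continuous_domRestrict.1 hcont).stronglyMeasurable.comp_measurable
      (hT.subtype_mk (h := hTK))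
  refine (hf.norm.mul_const C).mono' (hf.aestronglyMeasurable.smul hm.aestronglyMeasurable)
    (Eventually.of_forall fun y => ?_)
  rw [norm_smul]
  gcongr
  exact hC _ (hTK y)

lemma contDiffOn_fderiv_comp_inl {G : Eu n × Eu n → F} (hΩ : IsOpen Ω)
    (hG : ContDiffOn ℝ ∞ G Ω) :
    ContDiffOn ℝ ∞
      (fun p => (fderiv ℝ G p).comp (ContinuousLinearMap.inl ℝ (Eu n) (Eu n))) Ω := by
  have h : ContDiffOn ℝ ∞ (fun p => fderiv ℝ G p) Ω := hG.fderiv_of_isOpen hΩ (by simp)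
  have hc : ContDiffOn ℝ ∞ (fun _ : Eu n × Eu n => ContinuousLinearMap.inl ℝ (Eu n) (Eu n)) Ω :=
    contDiffOn_const
  exact h.clm_comp hc

lemma hasFDerivAt_integral_smul_comp_prodMk {G : Eu n × Eu n → F} (hΩ : IsOpen Ω)
    (hU : IsOpen U) (hG : ContDiffOn ℝ ∞ G Ω) (hK : IsCompact K) (hUK : U ×ˢ K ⊆ Ω)
    (hf : Integrable f) (hT : Measurable T) (hTK : ∀ y, T y ∈ K) {x : Eu n} (hx : x ∈ U) :
    HasFDerivAt (fun x => ∫ y, f y • G (x, T y))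
      (∫ y, f y • (fderiv ℝ G (x, T y)).comp (ContinuousLinearMap.inl ℝ (Eu n) (Eu n))) x := by
  obtain ⟨r, hr, hrU⟩ := Metric.nhds_basis_closedBall.mem_iff.1 (hU.mem_nhds hx)
  have hG' := (contDiffOn_fderiv_comp_inl hΩ hG).continuousOn
  obtain ⟨C, hC⟩ := ((isCompact_closedBall x r).prod hK).exists_bound_of_continuousOn
    (hG'.mono ((prod_mono_left hrU).trans hUK))
  refine hasFDerivAt_integral_of_dominated_of_fderiv_le (s := closedBall x r)
    (F' := fun x y => f y • (fderiv ℝ G (x, T y)).comp (ContinuousLinearMap.inl ℝ (Eu n) (Eu n)))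
    (bound := fun y => ‖f y‖ * C)
    (closedBall_mem_nhds x hr) ?_ ?_ ?_ ?_ (hf.norm.mul_const C) ?_
  · filter_upwards [hU.mem_nhds hx] with z hz
    exact (integrable_smul_comp_prodMk hG.continuousOn hK hUK hf hT hTK hz).aestronglyMeasurable
  · exact integrable_smul_comp_prodMk hG.continuousOn hK hUK hf hT hTK hx
  · exact (integrable_smul_comp_prodMk hG' hK hUK hf hT hTK hx).aestronglyMeasurable
  · refine Eventually.of_forall fun y z hz => ?_
    rw [norm_smul]
    gcongr
    exact hC (z, T y) ⟨hz, hTK y⟩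
  · refine Eventually.of_forall fun y z hz => ?_
    have hp : (z, T y) ∈ Ω := hUK (mk_mem_prod (hrU hz) (hTK y))
    have hd : HasFDerivAt G (fderiv ℝ G (z, T y)) (z, T y) :=
      ((hG.contDiffAt (hΩ.mem_nhds hp)).differentiableAt (by simp)).hasFDerivAt
    have hi : HasFDerivAt (fun w : Eu n => (w, T y)) (ContinuousLinearMap.inl ℝ (Eu n) (Eu n)) z :=
      hasFDerivAt_prodMk_left z (T y)
    have hd' := HasFDerivAt.comp (g := G) (f := fun w : Eu n => (w, T y)) z hd hi
    exact HasFDerivAt.fun_const_smul hd' (f y)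

lemma contDiffOn_integral_smul_comp_prodMk (hΩ : IsOpen Ω) (hU : IsOpen U) (hK : IsCompact K)
    (hUK : U ×ˢ K ⊆ Ω) (hf : Integrable f) (hT : Measurable T) (hTK : ∀ y, T y ∈ K)
    {G : Eu n × Eu n → F} (hG : ContDiffOn ℝ ∞ G Ω) :
    ContDiffOn ℝ ∞ (fun x => ∫ y, f y • G (x, T y)) U := by
  refine contDiffOn_infty.2 fun k => ?_
  induction k generalizing F with
  | zero =>
    exact contDiffOn_zero.2 fun x hx => (hasFDerivAt_integral_smul_comp_prodMk hΩ hU hG hK hUK hf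
      hT hTK hx).continuousAt.continuousWithinAt
  | succ k ih =>
    push_cast
    rw [contDiffOn_succ_iff_fderiv_of_isOpen hU]
    have hd := fun x (hx : x ∈ U) =>
      hasFDerivAt_integral_smul_comp_prodMk hΩ hU hG hK hUK hf hT hTK hx
    refine ⟨fun x hx => (hd x hx).differentiableAt.differentiableWithinAt, by simp, ?_⟩
    exact (ih (contDiffOn_fderiv_comp_inl hΩ hG)).congr fun x hx => (hd x hx).fderiv

lemma fderiv_integral_mul_comp_prodMk {G : Eu n × Eu n → ℝ} (hΩ : IsOpen Ω)
    (hU : IsOpen U) (hG : ContDiffOn ℝ ∞ G Ω) (hK : IsCompact K) (hUK : U ×ˢ K ⊆ Ω)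
    (hf : Integrable f) (hT : Measurable T) (hTK : ∀ y, T y ∈ K) {x : Eu n} (hx : x ∈ U)
    (e : Eu n) :
    fderiv ℝ (fun x => ∫ y, f y * G (x, T y)) x e =
      ∫ y, f y * fderiv ℝ G (x, T y) (e, 0) := by
  have h : fderiv ℝ (fun x => ∫ y, f y * G (x, T y)) x = _ :=
    (hasFDerivAt_integral_smul_comp_prodMk hΩ hU hG hK hUK hf hT hTK hx).fderiv
  rw [h, ContinuousLinearMap.integral_apply]
  · simp
  · exact integrable_smul_comp_prodMk (contDiffOn_fderiv_comp_inl hΩ hG).continuousOn hK hUK hf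
      hT hTK hx

lemma contDiffOn_fderiv_apply {G : Eu n × Eu n → ℝ} (hΩ : IsOpen Ω) (hG : ContDiffOn ℝ ∞ G Ω)
    (v : Eu n × Eu n) : ContDiffOn ℝ ∞ (fun p => fderiv ℝ G p v) Ω :=
  (hG.fderiv_of_isOpen hΩ (by simp)).clm_apply contDiffOn_const

lemma fderiv_comp_prodMk_left {G : Eu n × Eu n → ℝ} (hΩ : IsOpen Ω) (hG : ContDiffOn ℝ ∞ G Ω)
    {p : Eu n × Eu n} (hp : p ∈ Ω) (e : Eu n) :
    fderiv ℝ (fun x => G (x, p.2)) p.1 e = fderiv ℝ G p (e, 0) := by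
  have hd : HasFDerivAt G (fderiv ℝ G p) (p.1, p.2) :=
    ((hG.differentiableOn (by simp)).differentiableAt (hΩ.mem_nhds hp)).hasFDerivAt
  have h : fderiv ℝ (fun x => G (x, p.2)) p.1 = _ :=
    (hd.comp p.1 (hasFDerivAt_prodMk_left p.1 p.2)).fderiv
  rw [h]
  simp

lemma lap_comp_prodMk_left {G : Eu n × Eu n → ℝ} (hΩ : IsOpen Ω) (hG : ContDiffOn ℝ ∞ G Ω)
    {p : Eu n × Eu n} (hp : p ∈ Ω) :
    lap (fun x => G (x, p.2)) p.1 = ∑ i : Fin n,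
      fderiv ℝ (fun q => fderiv ℝ G q (EuclideanSpace.single i 1, 0)) p
        (EuclideanSpace.single i 1, 0) := by
  have hc : ContDiffAt ℝ ∞ (fun x => G (x, p.2)) p.1 :=
    (hG.contDiffAt (hΩ.mem_nhds hp)).comp p.1 (contDiffAt_id.prodMk contDiffAt_const)
  rw [lap_eq_sum_fderiv (hc.of_le (by norm_cast))]
  refine Finset.sum_congr rfl fun i _ => ?_
  rw [← fderiv_comp_prodMk_left hΩ (contDiffOn_fderiv_apply hΩ hG _) hp]
  congr 1
  refine Filter.EventuallyEq.fderiv_eq ?_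
  have : Continuous fun x : Eu n => (x, p.2) := by fun_prop
  filter_upwards [(this.tendsto p.1).eventually (hΩ.mem_nhds hp)] with x hx
  exact fderiv_comp_prodMk_left hΩ hG (p := (x, p.2)) hx _

lemma contDiffOn_lapIter_comp_prodMk_left {G : Eu n × Eu n → ℝ} (hΩ : IsOpen Ω)
    (hG : ContDiffOn ℝ ∞ G Ω) (k : ℕ) :
    ContDiffOn ℝ ∞ (fun p => lapIter k (fun x => G (x, p.2)) p.1) Ω := by
  induction k with
  | zero => exact hG
  | succ k ih =>
    refine ContDiffOn.congr ?_ fun p hp => lap_comp_prodMk_left hΩ ih hp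
    exact ContDiffOn.sum fun i _ =>
      contDiffOn_fderiv_apply hΩ (contDiffOn_fderiv_apply hΩ ih _) _

lemma lap_integral_mul_comp_prodMk {G : Eu n × Eu n → ℝ} (hΩ : IsOpen Ω)
    (hU : IsOpen U) (hG : ContDiffOn ℝ ∞ G Ω) (hK : IsCompact K) (hUK : U ×ˢ K ⊆ Ω)
    (hf : Integrable f) (hT : Measurable T) (hTK : ∀ y, T y ∈ K) {x : Eu n} (hx : x ∈ U) :
    lap (fun x => ∫ y, f y * G (x, T y)) x = ∫ y, f y * lap (fun x => G (x, T y)) x := by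
  have hc := (contDiffOn_integral_smul_comp_prodMk hΩ hU hK hUK hf hT hTK hG).contDiffAt
    (hU.mem_nhds hx)
  simp only [smul_eq_mul] at hc
  have hG2 := fun i : Fin n => contDiffOn_fderiv_apply hΩ
    (contDiffOn_fderiv_apply hΩ hG (EuclideanSpace.single i 1, 0)) (EuclideanSpace.single i 1, 0)
  rw [lap_eq_sum_fderiv (hc.of_le (by norm_cast))]
  simp only [fun y => lap_comp_prodMk_left hΩ hG (p := (x, T y)) (hUK ⟨hx, hTK y⟩), Finset.mul_sum]
  have hint : ∀ i : Fin n, Integrable fun y => f y * fderiv ℝ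
      (fun q => fderiv ℝ G q (EuclideanSpace.single i 1, 0)) (x, T y)
        (EuclideanSpace.single i 1, 0) := fun i =>
    integrable_smul_comp_prodMk (hG2 i).continuousOn hK hUK hf hT hTK hx
  rw [integral_finsetSum _ fun i _ => hint i]
  refine Finset.sum_congr rfl fun i _ => ?_
  rw [← fderiv_integral_mul_comp_prodMk hΩ hU (contDiffOn_fderiv_apply hΩ hG _) hK hUK hf hT hTK hx]
  congr 1
  refine Filter.EventuallyEq.fderiv_eq ?_
  filter_upwards [hU.mem_nhds hx] with z hz
  exact fderiv_integral_mul_comp_prodMk hΩ hU hG hK hUK hf hT hTK hz _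

lemma lapIter_integral_mul_comp_prodMk {G : Eu n × Eu n → ℝ} (hΩ : IsOpen Ω)
    (hU : IsOpen U) (hG : ContDiffOn ℝ ∞ G Ω) (hK : IsCompact K) (hUK : U ×ˢ K ⊆ Ω)
    (hf : Integrable f) (hT : Measurable T) (hTK : ∀ y, T y ∈ K) (k : ℕ) :
    ∀ x ∈ U, lapIter k (fun x => ∫ y, f y * G (x, T y)) x =
      ∫ y, f y * lapIter k (fun x => G (x, T y)) x := by
  induction k with
  | zero => exact fun _ _ => rfl
  | succ k ih =>
    intro x hx
    rw [lapIter, lap_congr (EqOn.eventuallyEq_of_mem ih (hU.mem_nhds hx))]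
    exact lap_integral_mul_comp_prodMk hΩ hU (contDiffOn_lapIter_comp_prodMk_left hΩ hG k) hK hUK
      hf hT hTK hx

end ParametricIntegral

open scoped InnerProductSpace Convolution

section NearPart

variable {n : ℕ} {b g : Eu n → ℝ}

lemma fderiv_convolution_apply (hb : LocallyIntegrable b) (hg : ContDiff ℝ ∞ g)
    (hc : HasCompactSupport g) (e x : Eu n) :
    fderiv ℝ (b ⋆[ContinuousLinearMap.mul ℝ ℝ] g) x e =
      (b ⋆[ContinuousLinearMap.mul ℝ ℝ] fun z => fderiv ℝ g z e) x := by
  rw [(hc.hasFDerivAt_convolution_right _ hb (hg.of_le (by simp)) x).fderiv]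
  exact convolution_precompR_apply _ hb (hc.fderiv ℝ) (hg.continuous_fderiv (by simp)) x e

lemma lap_convolution (hb : LocallyIntegrable b) (hg : ContDiff ℝ ∞ g)
    (hc : HasCompactSupport g) :
    lap (b ⋆[ContinuousLinearMap.mul ℝ ℝ] g) = b ⋆[ContinuousLinearMap.mul ℝ ℝ] lap g := by
  funext x
  have hW : ContDiff ℝ ∞ (b ⋆[ContinuousLinearMap.mul ℝ ℝ] g) :=
    hc.contDiff_convolution_right _ hb hg
  have hd : ∀ {φ : Eu n → ℝ}, ContDiff ℝ ∞ φ → ∀ e : Eu n,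
      ContDiff ℝ ∞ fun z => fderiv ℝ φ z e :=
    fun hφ e => (hφ.fderiv_right (by simp)).clm_apply contDiff_const
  have hdc : ∀ {φ : Eu n → ℝ}, HasCompactSupport φ → ∀ e : Eu n,
      HasCompactSupport fun z => fderiv ℝ φ z e := fun hφ e => hφ.fderiv_apply ℝ e
  rw [lap_eq_sum_fderiv (hW.contDiffAt.of_le (by norm_cast))]
  have h1 : ∀ e : Eu n, (fun z => fderiv ℝ (b ⋆[ContinuousLinearMap.mul ℝ ℝ] g) z e) =
      b ⋆[ContinuousLinearMap.mul ℝ ℝ] fun z => fderiv ℝ g z e :=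
    fun e => funext (fderiv_convolution_apply hb hg hc e)
  simp only [h1, fderiv_convolution_apply hb (hd hg _) (hdc hc _)]
  have h2 : lap g = fun z => ∑ i, fderiv ℝ (fun w => fderiv ℝ g w (EuclideanSpace.single i 1)) z
      (EuclideanSpace.single i 1) :=
    funext fun z => lap_eq_sum_fderiv (hg.contDiffAt.of_le (by norm_cast))
  rw [h2]
  simp only [convolution_def, ContinuousLinearMap.mul_apply', Finset.mul_sum]
  refine (integral_finsetSum _ fun i _ => ?_).symm
  exact (hdc (hdc hc _) _).convolutionExists_right (ContinuousLinearMap.mul ℝ ℝ) hb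
    (hd (hd hg _) _).continuous x

lemma lapIter_convolution (hb : LocallyIntegrable b) (hg : ContDiff ℝ ∞ g)
    (hc : HasCompactSupport g) (k : ℕ) :
    lapIter k (b ⋆[ContinuousLinearMap.mul ℝ ℝ] g) =
      b ⋆[ContinuousLinearMap.mul ℝ ℝ] lapIter k g := by
  induction k with
  | zero => rfl
  | succ k ih => rw [lapIter, ih, lap_convolution hb (hg.lapIter k) (hc.lapIter k), lapIter]

lemma log_norm_div_norm_sub_mul_ae_eq (hn : 1 ≤ n) (g : Eu n → ℝ) (x : Eu n) :
    (fun y => Real.log (‖y‖ / ‖x - y‖) * g y) =ᵐ[volume] fun y =>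
      1 / 2 * (Real.log (‖y‖ ^ 2) * g y) - 1 / 2 * (Real.log (‖x - y‖ ^ 2) * g y) := by
  have := nontrivial_Eu hn
  filter_upwards [Measure.ae_ne volume 0, Measure.ae_ne volume x] with y hy hyx
  rw [Real.log_div (norm_ne_zero_iff.2 hy) (norm_ne_zero_iff.2 (sub_ne_zero.2 hyx.symm)),
    Real.log_pow, Real.log_pow]
  push_cast
  ring

lemma integrable_log_norm_sq_sub_mul (hn : 2 ≤ n) (hg : Continuous g)
    (hc : HasCompactSupport g) (x : Eu n) :
    Integrable fun y => Real.log (‖x - y‖ ^ 2) * g y := by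
  have h := (hc.convolutionExists_right (ContinuousLinearMap.mul ℝ ℝ)
    (locallyIntegrable_log_norm_sq hn) hg x).comp_sub_left x
  simpa using h

lemma integrable_log_norm_div_mul_of_hasCompactSupport (hn : 2 ≤ n) (hg : Continuous g)
    (hc : HasCompactSupport g) (x : Eu n) :
    Integrable fun y => Real.log (‖y‖ / ‖x - y‖) * g y := by
  refine Integrable.congr ?_ (log_norm_div_norm_sub_mul_ae_eq (by lia) g x).symm
  exact (((locallyIntegrable_log_norm_sq hn).integrable_mul_of_hasCompactSupport hg hc).const_mul
    _).sub ((integrable_log_norm_sq_sub_mul hn hg hc x).const_mul _)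

lemma integral_log_norm_div_mul_eq_convolution (hn : 2 ≤ n) (hg : Continuous g)
    (hc : HasCompactSupport g) :
    (fun x => ∫ y, Real.log (‖y‖ / ‖x - y‖) * g y) = fun x =>
      1 / 2 * (∫ y, Real.log (‖y‖ ^ 2) * g y) -
      1 / 2 * ((fun z : Eu n => Real.log (‖z‖ ^ 2)) ⋆[ContinuousLinearMap.mul ℝ ℝ] g) x := by
  funext x
  rw [integral_congr_ae (log_norm_div_norm_sub_mul_ae_eq (by lia) g x), integral_sub
    (((locallyIntegrable_log_norm_sq hn).integrable_mul_of_hasCompactSupport hg hc).const_mul _)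
    ((integrable_log_norm_sq_sub_mul hn hg hc x).const_mul _), integral_const_mul,
    integral_const_mul, convolution_def,
    ← integral_sub_left_eq_self (fun y => Real.log (‖x - y‖ ^ 2) * g y) volume x]
  simp

lemma contDiff_integral_log_norm_div_mul (hn : 2 ≤ n) (hg : ContDiff ℝ ∞ g)
    (hc : HasCompactSupport g) :
    ContDiff ℝ ∞ fun x => ∫ y, Real.log (‖y‖ / ‖x - y‖) * g y := by
  rw [integral_log_norm_div_mul_eq_convolution hn hg.continuous hc]
  exact contDiff_const.sub (contDiff_const.mul
    (hc.contDiff_convolution_right _ (locallyIntegrable_log_norm_sq hn) hg))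

lemma lapIter_integral_log_norm_div_mul {m : ℕ} (hm : 1 ≤ m) {g : Eu (m + m) → ℝ}
    (hg : ContDiff ℝ ∞ g) (hc : HasCompactSupport g) (x : Eu (m + m)) :
    lapIter m (fun x => ∫ y, Real.log (‖y‖ / ‖x - y‖) * g y) x =
      1 / 2 * ((-4) ^ m * (m - 1).factorial * Real.pi ^ m) * g x := by
  have hb := locallyIntegrable_log_norm_sq (n := m + m) (by lia)
  have hW := hc.contDiff_convolution_right (ContinuousLinearMap.mul ℝ ℝ) hb hg
  rw [integral_log_norm_div_mul_eq_convolution (by lia) hg.continuous hc,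
    lapIter_sub isOpen_univ (fun _ _ => contDiffAt_const)
      (fun _ _ => (contDiff_const.mul hW).contDiffAt) m x (mem_univ x),
    lapIter_const _ hm, lapIter_const_mul _ isOpen_univ (fun _ _ => hW.contDiffAt) m x (mem_univ x),
    lapIter_convolution hb hg hc, convolution_def]
  have h : ∫ t, Real.log (‖t‖ ^ 2) * lapIter m g (x - t) =
      ∫ t, Real.log (‖t‖ ^ 2) * lapIter m (fun z => g (z + x)) t := by
    rw [← integral_neg_eq_self, lapIter_comp_add_right]
    simp [add_comm]
  simp only [ContinuousLinearMap.mul_apply', h]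
  have hgx : ContDiff ℝ ∞ fun z => g (z + x) := hg.comp (contDiff_id.add contDiff_const)
  have hcx : HasCompactSupport fun z => g (z + x) := hc.comp_homeomorph (Homeomorph.addRight x)
  rw [integral_log_norm_sq_mul_lapIter hm hgx hcx]
  simp
  ring

end NearPart

section FarPart

variable {n : ℕ}

/-- Evaluated at `(x, y / ‖y‖ ^ 2)`, this is `log (‖y‖ / ‖x - y‖)`; unlike the latter it is
smooth for `y` near infinity. -/
def invertedLogKernel (p : Eu n × Eu n) : ℝ :=
  -(1 / 2) * Real.log (1 - 2 * ⟪p.1, p.2⟫_ℝ + ‖p.1‖ ^ 2 * ‖p.2‖ ^ 2)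

lemma contDiffOn_invertedLogKernel : ContDiffOn ℝ ∞ (invertedLogKernel (n := n))
    {p | 0 < 1 - 2 * ⟪p.1, p.2⟫_ℝ + ‖p.1‖ ^ 2 * ‖p.2‖ ^ 2} := by
  refine contDiffOn_const.mul (ContDiffOn.log ?_ fun p hp => ne_of_gt hp)
  refine ContDiff.contDiffOn ?_
  exact (contDiff_const.sub (contDiff_const.mul (contDiff_fst.inner ℝ contDiff_snd))).add
    ((contDiff_fst.norm_sq ℝ).mul (contDiff_snd.norm_sq ℝ))

lemma isOpen_domain_invertedLogKernel :
    IsOpen {p : Eu n × Eu n | 0 < 1 - 2 * ⟪p.1, p.2⟫_ℝ + ‖p.1‖ ^ 2 * ‖p.2‖ ^ 2} :=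
  isOpen_lt continuous_const (by fun_prop)

lemma ball_prod_closedBall_subset {R : ℝ} (hR : 0 < R) :
    ball (0 : Eu n) R ×ˢ closedBall 0 (2 * R)⁻¹ ⊆
      {p | 0 < 1 - 2 * ⟪p.1, p.2⟫_ℝ + ‖p.1‖ ^ 2 * ‖p.2‖ ^ 2} := by
  rintro ⟨x, w⟩ ⟨hx, hw⟩
  simp only [mem_ball_zero_iff, mem_closedBall_zero_iff] at hx hw
  have h1 : ‖x‖ * ‖w‖ ≤ 1 / 2 := by
    calc ‖x‖ * ‖w‖ ≤ R * (2 * R)⁻¹ := by gcongr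
      _ = 1 / 2 := by field_simp
  have h2 := real_inner_le_norm x w
  simp only [mem_ofPred_eq]
  nlinarith [sq_nonneg (1 - ‖x‖ * ‖w‖)]

lemma invertedLogKernel_inv_smul {x y : Eu n} (hy : y ≠ 0) (hxy : x ≠ y) :
    invertedLogKernel (x, (‖y‖ ^ 2)⁻¹ • y) =
      1 / 2 * Real.log (‖y‖ ^ 2) - 1 / 2 * Real.log (‖x - y‖ ^ 2) := by
  have hy' : ‖y‖ ≠ 0 := norm_ne_zero_iff.2 hy
  have hxy' : ‖x - y‖ ≠ 0 := norm_ne_zero_iff.2 (sub_ne_zero.2 hxy)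
  have h : 1 - 2 * ⟪x, (‖y‖ ^ 2)⁻¹ • y⟫_ℝ + ‖x‖ ^ 2 * ‖(‖y‖ ^ 2)⁻¹ • y‖ ^ 2 =
      ‖x - y‖ ^ 2 / ‖y‖ ^ 2 := by
    rw [norm_sub_sq_real, inner_smul_right, norm_smul, norm_inv, norm_pow, norm_norm]
    field_simp
    ring
  rw [invertedLogKernel, h, Real.log_div (pow_ne_zero 2 hxy') (pow_ne_zero 2 hy')]
  ring

lemma lapIter_invertedLogKernel_inv_smul {m : ℕ} (hm : 1 ≤ m) {x y : Eu (m + m)} (hy : y ≠ 0)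
    (hxy : x ≠ y) :
    lapIter m (fun x => invertedLogKernel (x, (‖y‖ ^ 2)⁻¹ • y)) x = 0 := by
  have hU : IsOpen {z : Eu (m + m) | z ≠ y} := isOpen_ne
  have hs : ∀ z ∈ {z : Eu (m + m) | z ≠ y},
      ContDiffAt ℝ ∞ (fun z => Real.log (‖z - y‖ ^ 2)) z := fun z hz =>
    ContDiffAt.log ((contDiff_id.sub contDiff_const).norm_sq ℝ).contDiffAt
      (pow_ne_zero 2 (norm_ne_zero_iff.2 (sub_ne_zero.2 hz)))
  have h : lapIter m (fun z => Real.log (‖z - y‖ ^ 2)) x = 0 := by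
    have := congrFun (lapIter_comp_add_right (fun z : Eu (m + m) => Real.log (‖z‖ ^ 2)) (-y) m) x
    simp only [← sub_eq_add_neg] at this
    rw [this, lapIter_log_norm_sq hm (sub_ne_zero.2 hxy)]
  rw [lapIter_congr hU (fun z hz => invertedLogKernel_inv_smul hy hz) m hxy,
    lapIter_sub hU (fun _ _ => contDiffAt_const) (fun z hz => contDiffAt_const.mul (hs z hz)) m x
      hxy, lapIter_const _ hm, lapIter_const_mul _ hU hs m x hxy, h]
  simp

/-- Inversion in the unit sphere, truncated to the complement of the ball of radius `r`. -/
def truncatedInversion (r : ℝ) (y : Eu n) : Eu n := if ‖y‖ < r then 0 else (‖y‖ ^ 2)⁻¹ • y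

lemma measurable_truncatedInversion (r : ℝ) : Measurable (truncatedInversion (n := n) r) := by
  refine Measurable.ite (measurableSet_lt measurable_norm measurable_const) measurable_const ?_
  fun_prop

lemma truncatedInversion_mem_closedBall {r : ℝ} (hr : 0 < r) (y : Eu n) :
    truncatedInversion r y ∈ closedBall 0 r⁻¹ := by
  rw [mem_closedBall_zero_iff, truncatedInversion]
  split_ifs with h
  · simpa using hr.le
  · have hy : 0 < ‖y‖ := hr.trans_le (not_lt.1 h)
    rw [norm_smul, norm_inv, norm_pow, norm_norm, pow_two, mul_inv, mul_assoc,
      inv_mul_cancel₀ hy.ne', mul_one]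
    exact inv_anti₀ hr (not_lt.1 h)

variable {R : ℝ} {f : Eu n → ℝ}

lemma log_norm_div_mul_eq_mul_invertedLogKernel (hR : 0 < R) (h0 : ∀ y, ‖y‖ < 2 * R → f y = 0)
    {x : Eu n} (hx : x ∈ ball 0 R) (y : Eu n) :
    Real.log (‖y‖ / ‖x - y‖) * f y = f y * invertedLogKernel (x, truncatedInversion (2 * R) y) := by
  by_cases h : ‖y‖ < 2 * R
  · simp [h0 y h]
  have hy : y ≠ 0 := by
    rintro rfl
    exact h (by simpa using hR)
  have hxy : x ≠ y := by
    rintro rfl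
    exact h ((mem_ball_zero_iff.1 hx).trans (by linarith))
  rw [truncatedInversion, if_neg h, invertedLogKernel_inv_smul hy hxy,
    Real.log_div (norm_ne_zero_iff.2 hy) (norm_ne_zero_iff.2 (sub_ne_zero.2 hxy)),
    Real.log_pow, Real.log_pow]
  push_cast
  ring

lemma integrable_log_norm_div_mul_of_far (hR : 0 < R) (hf : Integrable f)
    (h0 : ∀ y, ‖y‖ < 2 * R → f y = 0) {x : Eu n} (hx : x ∈ ball 0 R) :
    Integrable fun y => Real.log (‖y‖ / ‖x - y‖) * f y := by
  simp only [log_norm_div_mul_eq_mul_invertedLogKernel hR h0 hx]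
  exact integrable_smul_comp_prodMk contDiffOn_invertedLogKernel.continuousOn
    (isCompact_closedBall 0 (2 * R)⁻¹) (ball_prod_closedBall_subset hR) hf
    (measurable_truncatedInversion _) (truncatedInversion_mem_closedBall (by positivity)) hx

lemma contDiffOn_integral_log_norm_div_mul_of_far (hR : 0 < R) (hf : Integrable f)
    (h0 : ∀ y, ‖y‖ < 2 * R → f y = 0) :
    ContDiffOn ℝ ∞ (fun x => ∫ y, Real.log (‖y‖ / ‖x - y‖) * f y) (ball 0 R) := by
  refine ContDiffOn.congr (contDiffOn_integral_smul_comp_prodMk isOpen_domain_invertedLogKernel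
    isOpen_ball (isCompact_closedBall 0 (2 * R)⁻¹) (ball_prod_closedBall_subset hR) hf
    (measurable_truncatedInversion _) (truncatedInversion_mem_closedBall (by positivity))
    contDiffOn_invertedLogKernel) fun x hx => ?_
  simp only [log_norm_div_mul_eq_mul_invertedLogKernel hR h0 hx, smul_eq_mul]

lemma lapIter_integral_log_norm_div_mul_of_far {m : ℕ} (hm : 1 ≤ m) {f : Eu (m + m) → ℝ}
    (hR : 0 < R) (hf : Integrable f) (h0 : ∀ y, ‖y‖ < 2 * R → f y = 0)
    {x : Eu (m + m)} (hx : x ∈ ball 0 R) :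
    lapIter m (fun x => ∫ y, Real.log (‖y‖ / ‖x - y‖) * f y) x = 0 := by
  have h : EqOn (fun x => ∫ y, Real.log (‖y‖ / ‖x - y‖) * f y)
      (fun x => ∫ y, f y * invertedLogKernel (x, truncatedInversion (2 * R) y)) (ball 0 R) :=
    fun x hx => by simp only [log_norm_div_mul_eq_mul_invertedLogKernel hR h0 hx]
  rw [lapIter_congr isOpen_ball h m hx,
    lapIter_integral_mul_comp_prodMk isOpen_domain_invertedLogKernel isOpen_ball
      contDiffOn_invertedLogKernel (isCompact_closedBall 0 (2 * R)⁻¹)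
      (ball_prod_closedBall_subset hR) hf (measurable_truncatedInversion _)
      (truncatedInversion_mem_closedBall (by positivity)) m x hx]
  refine integral_eq_zero_of_ae (Eventually.of_forall fun y => ?_)
  by_cases hy : ‖y‖ < 2 * R
  · simp [h0 y hy]
  have hy0 : y ≠ 0 := by
    rintro rfl
    exact hy (by simpa using hR)
  have hxy : x ≠ y := by
    rintro rfl
    exact hy ((mem_ball_zero_iff.1 hx).trans (by linarith))
  simp only [truncatedInversion, if_neg hy, Pi.zero_apply]
  rw [lapIter_invertedLogKernel_inv_smul hm hy0 hxy, mul_zero]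

end FarPart

lemma exists_near_far_decomposition {n : ℕ} {f : Eu n → ℝ} (hf : ContDiff ℝ ∞ f)
    (hfL1 : Integrable f) {R : ℝ} (hR : 0 < R) :
    ∃ g h : Eu n → ℝ, (∀ y, f y = g y - h y) ∧ ContDiff ℝ ∞ g ∧ HasCompactSupport g ∧
      Integrable h ∧ ∀ y, ‖y‖ < 2 * R → h y = 0 := by
  let χ : ContDiffBump (0 : Eu n) := ⟨2 * R, 3 * R, by linarith, by linarith⟩
  have hg : ContDiff ℝ ∞ fun y => χ y * f y := χ.contDiff.mul hf
  have hc : HasCompactSupport fun y => χ y * f y := χ.hasCompactSupport.mul_right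
  refine ⟨fun y => χ y * f y, fun y => χ y * f y - f y, fun y => by ring, hg, hc,
    (hg.continuous.integrable_of_hasCompactSupport hc).sub hfL1, fun y hy => ?_⟩
  change χ y * f y - f y = 0
  rw [χ.one_of_mem_closedBall (mem_closedBall_zero_iff.2 hy.le)]
  ring

/-- The local structure of the logarithmic potential `∫ log (‖y‖ / ‖x - y‖) f(y) dy`. -/
lemma logPotential_local {m : ℕ} (hm : 1 ≤ m) {f : Eu (m + m) → ℝ} (hf : ContDiff ℝ ∞ f)
    (hfL1 : Integrable f) (x : Eu (m + m)) :
    Integrable (fun y => Real.log (‖y‖ / ‖x - y‖) * f y) ∧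
    ContDiffAt ℝ ∞ (fun x => ∫ y, Real.log (‖y‖ / ‖x - y‖) * f y) x ∧
    lapIter m (fun x => ∫ y, Real.log (‖y‖ / ‖x - y‖) * f y) x =
      1 / 2 * ((-4) ^ m * (m - 1).factorial * Real.pi ^ m) * f x := by
  have hR : 0 < ‖x‖ + 1 := by positivity
  have hx : x ∈ ball 0 (‖x‖ + 1) := by simp
  have hn : 2 ≤ m + m := by lia
  obtain ⟨g, h, hfgh, hg, hgc, hh, h0⟩ := exists_near_far_decomposition hf hfL1 hR
  have hgi := integrable_log_norm_div_mul_of_hasCompactSupport hn hg.continuous hgc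
  have hhi := fun z hz => integrable_log_norm_div_mul_of_far hR hh h0 (x := z) hz
  have hgs := contDiff_integral_log_norm_div_mul hn hg hgc
  have hhs := fun z hz => (contDiffOn_integral_log_norm_div_mul_of_far hR hh h0).contDiffAt
    (isOpen_ball.mem_nhds (x := z) hz)
  have heq : EqOn (fun x => ∫ y, Real.log (‖y‖ / ‖x - y‖) * f y)
      (fun x => (∫ y, Real.log (‖y‖ / ‖x - y‖) * g y) - ∫ y, Real.log (‖y‖ / ‖x - y‖) * h y)
      (ball 0 (‖x‖ + 1)) := fun z hz => by
    simp only [hfgh, mul_sub]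
    exact integral_sub (hgi z) (hhi z hz)
  refine ⟨?_, ?_, ?_⟩
  · simp only [hfgh, mul_sub]
    exact (hgi x).sub (hhi x hx)
  · exact (hgs.contDiffAt.sub (hhs x hx)).congr_of_eventuallyEq
      (heq.eventuallyEq_of_mem (isOpen_ball.mem_nhds hx))
  · rw [lapIter_congr isOpen_ball heq m hx, lapIter_sub isOpen_ball
      (fun z _ => hgs.contDiffAt) hhs m x hx, lapIter_integral_log_norm_div_mul hm hg hgc,
      lapIter_integral_log_norm_div_mul_of_far hm hR hh h0 hx, hfgh x,
      h0 x (by linarith [norm_nonneg x])]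
    ring

lemma cQ_pos (n : ℕ) : 0 < cQ n := by
  unfold cQ
  positivity

lemma cQ_add_self {m : ℕ} (hm : 1 ≤ m) :
    4 * cQ (m + m) = 4 ^ m * (m - 1).factorial * Real.pi ^ m := by
  obtain ⟨k, rfl⟩ := Nat.exists_eq_add_of_le' hm
  have h1 : k + 1 + (k + 1) - 2 = 2 * k := by lia
  have h2 : (k + 1 + (k + 1)) / 2 = k + 1 := by lia
  rw [cQ, h1, h2, Nat.mul_div_cancel_left k two_pos, pow_mul, Nat.add_sub_cancel, pow_succ 4 k]
  norm_num
  ring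

/-- **Fundamental solution property of the logarithmic potential.** For `n ≥ 2` even and
`f ∈ C^∞ ∩ L¹(ℝⁿ)`, the potential `v(x) = (1/(2cₙ)) ∫ log(|y|/|x-y|) f(y) dy` is
absolutely convergent, smooth, and solves `(-Δ)^{n/2} v = f`. In particular for smooth `u`
with `f = (-Δ)^{n/2}u`, the function `h = u - v` satisfies `Δ^{n/2} h ≡ 0`. -/
theorem potential_solves_polyharmonic
    (n : ℕ) (hn : 2 ≤ n) (hev : Even n)
    (f : Eu n → ℝ) (hf : ContDiff ℝ (⊤ : ℕ∞) f) (hfL1 : Integrable f)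
    (v : Eu n → ℝ)
    (hv : ∀ x, v x = (1 / (2 * cQ n)) * ∫ y, Real.log (‖y‖ / ‖x - y‖) * f y) :
    (∀ x : Eu n, Integrable (fun y => Real.log (‖y‖ / ‖x - y‖) * f y)) ∧
    ContDiff ℝ (⊤ : ℕ∞) v ∧
    (∀ x : Eu n, (-1 : ℝ) ^ (n / 2) * lapIter (n / 2) v x = f x) ∧
    ∀ u : Eu n → ℝ, ContDiff ℝ (⊤ : ℕ∞) u →
      (∀ x, f x = (-1 : ℝ) ^ (n / 2) * lapIter (n / 2) u x) →
        ∀ x : Eu n, lapIter (n / 2) (fun z => u z - v z) x = 0 := by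
  obtain ⟨m, rfl⟩ := hev
  have hm : 1 ≤ m := by lia
  have hdiv : (m + m) / 2 = m := by lia
  have key := logPotential_local hm hf hfL1
  have hvs : ContDiff ℝ ∞ v := by
    rw [funext hv]
    exact contDiff_iff_contDiffAt.2 fun x => contDiffAt_const.mul (key x).2.1
  have hsq : (-1 : ℝ) ^ m * (-1) ^ m = 1 := by rw [← mul_pow]; norm_num
  have hsol : ∀ x, (-1 : ℝ) ^ m * lapIter m v x = f x := fun x => by
    rw [funext hv, lapIter_const_mul _ isOpen_univ (fun z _ => (key z).2.1) m x (mem_univ x),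
      (key x).2.2, neg_pow 4, mul_assoc ((-1 : ℝ) ^ m), mul_assoc ((-1 : ℝ) ^ m), ← cQ_add_self hm]
    have := (cQ_pos (m + m)).ne'
    field_simp
    linear_combination (4 * f x) * hsq
  rw [hdiv]
  refine ⟨fun x => (key x).1, hvs, hsol, fun u hu hfu x => ?_⟩
  rw [lapIter_sub isOpen_univ (fun _ _ => hu.contDiffAt) (fun _ _ => hvs.contDiffAt) m x
    (mem_univ x)]
  have h := (hsol x).trans (hfu x)
  have := mul_left_cancel₀ (pow_ne_zero m (by norm_num)) h
  rw [this, sub_self]
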